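/- arXiv:2204.04848 — 2 statements merged into one kernel-verified Lean document; each statement's English description precedes it below -/
import Mathlib

section
/- (Outgoing-path dominance) Let P_1 and P_2 be outgoing paths with k vertices each (1 ≤ k ≤ n) that have the same configuration, i.e., they end at the same vertex and visit the same set of vertices. If u^F(P_1) < u^F(P_2), then no optimal repair sequence starts with P_2: for every repair sequence σ that starts with P_2, the repair sequence σ' obtained from σ by replacing its first k entries with P_1 satisfies T(σ') < T(σ). -/
/-- `W n pre S` is the number of vertices of `V_c = {1,…,n}` without power service
when exactly the vertices in `S` have been repaired: vertices `j` having some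
predecessor-or-self `i` (i.e. `pre i j`) that is not in `S`. -/
noncomputable def W (n : ℕ) (pre : ℕ → ℕ → Prop) (S : Finset ℕ) : ℕ :=
  {j | j ∈ Finset.Icc 1 n ∧ ∃ i ∈ Finset.Icc 1 n, pre i j ∧ i ∉ S}.ncard

/-- `jseq σ p` is the `p`-th visited vertex: the depot `0` for `p = 0`, and `σ p` otherwise. -/
def jseq (σ : ℕ → ℕ) (p : ℕ) : ℕ := if p = 0 then 0 else σ p

/-- Arrival time at the `p`-th visited vertex: `t_p = ∑_{q=1}^p d(j_{q-1}, j_q)`. -/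
def arrival (d : ℕ → ℕ → ℝ) (σ : ℕ → ℕ) (p : ℕ) : ℝ :=
  ∑ q ∈ Finset.Icc 1 p, d (jseq σ (q - 1)) (jseq σ q)

/-- `lastPos n pre σ i = max { p ∈ [1,n] : σ p ⪰ i }`, the position at which the
service of vertex `i` is restored. -/
noncomputable def lastPos (n : ℕ) (pre : ℕ → ℕ → Prop) (σ : ℕ → ℕ) (i : ℕ) : ℕ :=
  sSup {p : ℕ | p ∈ Finset.Icc 1 n ∧ pre (σ p) i}

/-- Total service disruption time `T(σ) = ∑_{i ∈ V_c} r_i` where `r_i = t_{p(i)}`. -/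
noncomputable def totalT (n : ℕ) (d : ℕ → ℕ → ℝ) (pre : ℕ → ℕ → Prop) (σ : ℕ → ℕ) : ℝ :=
  ∑ i ∈ Finset.Icc 1 n, arrival d σ (lastPos n pre σ i)

/-- `uF n d pre k P = u^F(P) = ∑_{p=1}^{k} W({j_1,…,j_{p−1}}) · d(j_{p−1}, j_p)` for an
outgoing path `P = (j_1,…,j_k)` traversed from the depot `j_0 = 0`. -/
noncomputable def uF (n : ℕ) (d : ℕ → ℕ → ℝ) (pre : ℕ → ℕ → Prop) (k : ℕ) (P : ℕ → ℕ) : ℝ :=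
  ∑ p ∈ Finset.Icc 1 k, (W n pre ((Finset.Icc 1 (p - 1)).image P) : ℝ) * d (jseq P (p - 1)) (jseq P p)

/-- The service of `i` is restored at position `q` or later exactly when some predecessor of `i`
is visited at position `q` or later. -/
theorem le_lastPos_iff {n : ℕ} {pre : ℕ → ℕ → Prop} {σ : ℕ → ℕ} {q i : ℕ} (hq : 1 ≤ q) :
    q ≤ lastPos n pre σ i ↔ ∃ p ∈ Finset.Icc q n, pre (σ p) i := by
  have hbdd : BddAbove {p : ℕ | p ∈ Finset.Icc 1 n ∧ pre (σ p) i} :=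
    ⟨n, fun p hp => (Finset.mem_Icc.1 hp.1).2⟩
  constructor
  · intro h
    have hne : {p : ℕ | p ∈ Finset.Icc 1 n ∧ pre (σ p) i}.Nonempty := by
      by_contra hempty
      rw [Set.not_nonempty_iff_eq_empty] at hempty
      rw [lastPos, hempty, csSup_empty] at h
      exact absurd (hq.trans h) (by simp)
    obtain ⟨hmem, hpre⟩ := Nat.sSup_mem hne hbdd
    exact ⟨_, Finset.mem_Icc.2 ⟨h, (Finset.mem_Icc.1 hmem).2⟩, hpre⟩
  · rintro ⟨p, hp, hpre⟩
    rw [Finset.mem_Icc] at hp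
    exact hp.1.trans (le_csSup hbdd ⟨Finset.mem_Icc.2 ⟨hq.trans hp.1, hp.2⟩, hpre⟩)

theorem lastPos_le {n : ℕ} {pre : ℕ → ℕ → Prop} {σ : ℕ → ℕ} {i : ℕ} :
    lastPos n pre σ i ≤ n := by
  by_contra! h
  obtain ⟨p, hp, -⟩ := (le_lastPos_iff (Nat.succ_pos n)).1 (Nat.succ_le_of_lt h)
  rw [Finset.mem_Icc] at hp
  omega

/-- Before the `q`-th visit of a repair sequence, the vertices without service are those whose
service is restored at position `q` or later. -/
theorem W_image_eq_card {n : ℕ} {pre : ℕ → ℕ → Prop} {σ : ℕ → ℕ}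
    (hσ : Set.BijOn σ (Set.Icc 1 n) (Set.Icc 1 n)) {q : ℕ} (hq : 1 ≤ q) :
    W n pre ((Finset.Icc 1 (q - 1)).image σ) =
      ((Finset.Icc 1 n).filter (fun i => q ≤ lastPos n pre σ i)).card := by
  rw [W, ← Set.ncard_coe_finset]
  congr 1
  ext i
  simp only [Set.mem_ofPred_eq, Finset.coe_filter, le_lastPos_iff hq]
  refine and_congr_right fun _ => ?_
  constructor
  · rintro ⟨v, hv, hpre, hnot⟩
    obtain ⟨p, hp, rfl⟩ := hσ.surjOn (show v ∈ Set.Icc 1 n from Finset.mem_Icc.1 hv)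
    refine ⟨p, Finset.mem_Icc.2 ⟨?_, hp.2⟩, hpre⟩
    by_contra! hlt
    exact hnot (Finset.mem_image_of_mem σ (Finset.mem_Icc.2 ⟨hp.1, by omega⟩))
  · rintro ⟨p, hp, hpre⟩
    rw [Finset.mem_Icc] at hp
    have hpn : p ∈ Set.Icc 1 n := ⟨hq.trans hp.1, hp.2⟩
    refine ⟨σ p, Finset.mem_Icc.2 (hσ.mapsTo hpn), hpre, fun hmem => ?_⟩
    obtain ⟨p', hp', heq⟩ := Finset.mem_image.1 hmem
    rw [Finset.mem_Icc] at hp'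
    have := hσ.injOn ⟨hp'.1, by omega⟩ hpn heq
    omega

/-- The total service disruption time of a repair sequence is the travel time weighted by the
number of vertices without service. -/
theorem totalT_eq_uF {n : ℕ} {pre : ℕ → ℕ → Prop} {σ : ℕ → ℕ} (d : ℕ → ℕ → ℝ)
    (hσ : Set.BijOn σ (Set.Icc 1 n) (Set.Icc 1 n)) :
    totalT n d pre σ = uF n d pre n σ := by
  have harr : ∀ i, arrival d σ (lastPos n pre σ i) = ∑ q ∈ Finset.Icc 1 n,
      if q ≤ lastPos n pre σ i then d (jseq σ (q - 1)) (jseq σ q) else 0 := by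
    intro i
    rw [arrival, ← Finset.sum_filter]
    refine Finset.sum_congr ?_ fun _ _ => rfl
    ext q
    have := lastPos_le (n := n) (pre := pre) (σ := σ) (i := i)
    simp only [Finset.mem_filter, Finset.mem_Icc]
    omega
  rw [totalT, Finset.sum_congr rfl fun i _ => harr i, Finset.sum_comm, uF]
  refine Finset.sum_congr rfl fun q hq => ?_
  rw [W_image_eq_card hσ (Finset.mem_Icc.1 hq).1, ← Finset.sum_filter, Finset.sum_const,
    nsmul_eq_mul]

theorem jseq_congr {σ τ : ℕ → ℕ} {p : ℕ} (h : 1 ≤ p → σ p = τ p) : jseq σ p = jseq τ p := by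
  unfold jseq
  split_ifs with h0
  · rfl
  · exact h (Nat.one_le_iff_ne_zero.2 h0)

theorem uF_congr {n k : ℕ} {d : ℕ → ℕ → ℝ} {pre : ℕ → ℕ → Prop} {σ τ : ℕ → ℕ}
    (h : ∀ q ∈ Finset.Icc 1 k, σ q = τ q) : uF n d pre k σ = uF n d pre k τ := by
  refine Finset.sum_congr rfl fun p hp => ?_
  rw [Finset.mem_Icc] at hp
  have hle : ∀ q, 1 ≤ q → q ≤ p → σ q = τ q := fun q h1 h2 =>
    h q (Finset.mem_Icc.2 ⟨h1, h2.trans hp.2⟩)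
  have himage : (Finset.Icc 1 (p - 1)).image σ = (Finset.Icc 1 (p - 1)).image τ :=
    Finset.image_congr fun q hq => by
      have hq' := Finset.mem_Icc.1 (Finset.mem_coe.1 hq)
      exact hle q hq'.1 (by omega)
  rw [himage, jseq_congr (fun h1 => hle (p - 1) h1 (Nat.sub_le p 1)),
    jseq_congr (fun h1 => hle p h1 le_rfl)]

theorem image_Icc_eq_of_tail_eq {σ τ : ℕ → ℕ} {k m : ℕ} (hkm : k ≤ m)
    (himage : (Finset.Icc 1 k).image σ = (Finset.Icc 1 k).image τ)
    (htail : ∀ p ∈ Finset.Icc (k + 1) m, σ p = τ p) :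
    (Finset.Icc 1 m).image σ = (Finset.Icc 1 m).image τ := by
  have hsplit : Finset.Icc 1 m = Finset.Icc 1 k ∪ Finset.Icc (k + 1) m := by
    ext p
    simp only [Finset.mem_union, Finset.mem_Icc]
    omega
  rw [hsplit, Finset.image_union, Finset.image_union, himage]
  congr 1
  exact Finset.image_congr fun p hp => htail p (Finset.mem_coe.1 hp)

/-- Two sequences whose first `k` entries have the same configuration and which agree afterwards
accumulate the same cost after position `k`. -/
theorem uF_sub_uF_eq_of_tail_eq {n k m : ℕ} {d : ℕ → ℕ → ℝ} {pre : ℕ → ℕ → Prop}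
    {σ τ : ℕ → ℕ} (hkm : k ≤ m) (hlast : σ k = τ k)
    (himage : (Finset.Icc 1 k).image σ = (Finset.Icc 1 k).image τ)
    (htail : ∀ p ∈ Finset.Icc (k + 1) m, σ p = τ p) :
    uF n d pre m σ - uF n d pre k σ = uF n d pre m τ - uF n d pre k τ := by
  induction m, hkm using Nat.le_induction with
  | base => simp
  | succ m hkm ih =>
    have htail' : ∀ p ∈ Finset.Icc (k + 1) m, σ p = τ p := fun p hp =>
      htail p (Finset.Icc_subset_Icc_right (Nat.le_succ m) hp)
    have hstep : ∀ ρ : ℕ → ℕ, uF n d pre (m + 1) ρ = uF n d pre m ρ +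
        (W n pre ((Finset.Icc 1 m).image ρ) : ℝ) * d (jseq ρ m) (jseq ρ (m + 1)) := fun ρ =>
      Finset.sum_Icc_succ_top (Nat.le_add_left 1 m) _
    have hm : σ m = τ m := by
      rcases hkm.eq_or_lt with rfl | hlt
      · exact hlast
      · exact htail' m (Finset.mem_Icc.2 ⟨hlt, le_rfl⟩)
    have hm' : σ (m + 1) = τ (m + 1) := htail _ (Finset.mem_Icc.2 ⟨by omega, le_rfl⟩)
    rw [hstep, hstep, image_Icc_eq_of_tail_eq hkm himage htail', jseq_congr fun _ => hm,
      jseq_congr fun _ => hm']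
    linarith [ih htail']

/-- A sequence with the same range as a repair sequence is a repair sequence. -/
theorem bijOn_Icc_of_image_eq {n : ℕ} {σ τ : ℕ → ℕ}
    (hσ : Set.BijOn σ (Set.Icc 1 n) (Set.Icc 1 n))
    (himage : (Finset.Icc 1 n).image τ = (Finset.Icc 1 n).image σ) :
    Set.BijOn τ (Set.Icc 1 n) (Set.Icc 1 n) := by
  have hτ : (Finset.Icc 1 n).image τ = Finset.Icc 1 n := by
    rw [himage, ← Finset.coe_inj, Finset.coe_image, Finset.coe_Icc, hσ.image_eq]
  have hinj : Set.InjOn τ (Set.Icc 1 n) := by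
    rw [← Finset.coe_Icc, ← Finset.card_image_iff, hτ]
  have himg : τ '' Set.Icc 1 n = Set.Icc 1 n := by
    rw [← Finset.coe_Icc, ← Finset.coe_image, hτ]
  exact ⟨Set.mapsTo_iff_image_subset.2 himg.subset, hinj, himg.superset⟩

/-- **Outgoing-path dominance.** If outgoing paths `P_1, P_2` with `k`
vertices have the same configuration and `u^F(P_1) < u^F(P_2)`, then for every repair
sequence `σ` starting with `P_2`, the repair sequence `σ'` obtained from `σ` by
replacing its first `k` entries with `P_1` satisfies `T(σ') < T(σ)`. -/
theorem stmt10
    (n : ℕ) (hn : 1 ≤ n)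
    (d : ℕ → ℕ → ℝ) (hd : ∀ i j, 0 ≤ d i j)
    (pre : ℕ → ℕ → Prop)
    (hrefl : ∀ i ∈ Finset.Icc 1 n, pre i i)
    (htrans : ∀ i j k, pre i j → pre j k → pre i k)
    (hantisymm : ∀ i j, pre i j → pre j i → i = j)
    (k : ℕ) (hk1 : 1 ≤ k) (hk2 : k ≤ n)
    (P₁ P₂ : ℕ → ℕ)
    (hP₁inj : Set.InjOn P₁ (Set.Icc 1 k)) (hP₁mem : ∀ q ∈ Finset.Icc 1 k, P₁ q ∈ Finset.Icc 1 n)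
    (hP₂inj : Set.InjOn P₂ (Set.Icc 1 k)) (hP₂mem : ∀ q ∈ Finset.Icc 1 k, P₂ q ∈ Finset.Icc 1 n)
    (hlast : P₁ k = P₂ k)
    (hconfig : (Finset.Icc 1 k).image P₁ = (Finset.Icc 1 k).image P₂)
    (hu : uF n d pre k P₁ < uF n d pre k P₂)
    (σ : ℕ → ℕ) (hσ : Set.BijOn σ (Set.Icc 1 n) (Set.Icc 1 n))
    (hstart : ∀ q ∈ Finset.Icc 1 k, σ q = P₂ q)
    (σ' : ℕ → ℕ)
    (hσ'start : ∀ q ∈ Finset.Icc 1 k, σ' q = P₁ q)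
    (hσ'rest : ∀ p ∈ Finset.Icc (k + 1) n, σ' p = σ p) :
    totalT n d pre σ' < totalT n d pre σ := by
  have hfirst : (Finset.Icc 1 k).image σ' = (Finset.Icc 1 k).image σ := by
    rw [Finset.image_congr fun q hq => hσ'start q hq, hconfig]
    exact (Finset.image_congr fun q hq => hstart q hq).symm
  have hk : k ∈ Finset.Icc 1 k := Finset.mem_Icc.2 ⟨hk1, le_rfl⟩
  have hσ' : Set.BijOn σ' (Set.Icc 1 n) (Set.Icc 1 n) :=
    bijOn_Icc_of_image_eq hσ (image_Icc_eq_of_tail_eq hk2 hfirst hσ'rest)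
  have htail := uF_sub_uF_eq_of_tail_eq (n := n) (d := d) (pre := pre) hk2
    (by rw [hσ'start k hk, hstart k hk, hlast]) hfirst hσ'rest
  rw [uF_congr hσ'start, uF_congr hstart] at htail
  rw [totalT_eq_uF d hσ', totalT_eq_uF d hσ]
  linarith
end

section
/- The backward value at the initial state equals the optimal objective: v(0, V_c) equals the minimum of the total service disruption time T(σ) over all repair sequences σ. -/
/-- Backward value function `v(k, Y)`: the minimum over all orderings `(y_1,…,y_m)` of `Y`
(with `m = |Y|` and `y_0 = k`) of `∑_{p=1}^{m} W(V_c ∖ {y_p,…,y_m}) · d(y_{p−1}, y_p)`;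
in particular `v(k, ∅) = 0`. -/
noncomputable def vval (n : ℕ) (d : ℕ → ℕ → ℝ) (pre : ℕ → ℕ → Prop) (k : ℕ) (Y : Finset ℕ) : ℝ :=
  sInf { c : ℝ | ∃ y : ℕ → ℕ, Set.BijOn y (Set.Icc 1 Y.card) ↑Y ∧
    c = ∑ p ∈ Finset.Icc 1 Y.card,
      (W n pre (Finset.Icc 1 n \ (Finset.Icc p Y.card).image y) : ℝ) *
        d (if p = 1 then k else y (p - 1)) (y p) }

section Restoration

variable {n : ℕ} {pre : ℕ → ℕ → Prop} {σ : ℕ → ℕ}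

theorem lastPos_mem (hrefl : ∀ i ∈ Finset.Icc 1 n, pre i i)
    (hσ : Set.BijOn σ (Set.Icc 1 n) (Set.Icc 1 n)) {i : ℕ} (hi : i ∈ Finset.Icc 1 n) :
    lastPos n pre σ i ∈ Finset.Icc 1 n ∧ pre (σ (lastPos n pre σ i)) i := by
  obtain ⟨p, hp, rfl⟩ := hσ.surjOn (Finset.mem_Icc.mp hi)
  exact Nat.sSup_mem (s := {q | q ∈ Finset.Icc 1 n ∧ pre (σ q) (σ p)})
    ⟨p, Finset.mem_Icc.mpr hp, hrefl _ hi⟩ ⟨n, fun q hq => (Finset.mem_Icc.mp hq.1).2⟩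

theorem le_lastPos {i q : ℕ} (hq : q ∈ Finset.Icc 1 n) (h : pre (σ q) i) :
    q ≤ lastPos n pre σ i :=
  le_csSup ⟨n, fun _ hr => (Finset.mem_Icc.mp hr.1).2⟩ ⟨hq, h⟩

/-- Just before the `p`-th repair, the vertices without service are those restored at
position `p` or later. -/
theorem W_sdiff_image (hrefl : ∀ i ∈ Finset.Icc 1 n, pre i i)
    (hσ : Set.BijOn σ (Set.Icc 1 n) (Set.Icc 1 n)) {p : ℕ} (hp : 1 ≤ p) :
    W n pre (Finset.Icc 1 n \ (Finset.Icc p n).image σ)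
      = ((Finset.Icc 1 n).filter (fun i => p ≤ lastPos n pre σ i)).card := by
  rw [W, ← Set.ncard_coe_finset]
  congr 1
  ext j
  simp only [Set.mem_ofPred_eq, Finset.coe_filter]
  refine and_congr_right fun hj => ⟨?_, fun h => ?_⟩
  · rintro ⟨i, hi, hij, hiS⟩
    have himg : i ∈ (Finset.Icc p n).image σ := by
      by_contra h
      exact hiS (Finset.mem_sdiff.mpr ⟨hi, h⟩)
    obtain ⟨q, hq, rfl⟩ := Finset.mem_image.mp himg
    rw [Finset.mem_Icc] at hq
    exact hq.1.trans (le_lastPos (Finset.mem_Icc.mpr ⟨hp.trans hq.1, hq.2⟩) hij)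
  · obtain ⟨hmem, hpre⟩ := lastPos_mem hrefl hσ hj
    refine ⟨_, Finset.mem_Icc.mpr (hσ.mapsTo (Finset.mem_Icc.mp hmem)), hpre, fun hS => ?_⟩
    exact (Finset.mem_sdiff.mp hS).2 (Finset.mem_image_of_mem σ
      (Finset.mem_Icc.mpr ⟨h, (Finset.mem_Icc.mp hmem).2⟩))

/-- The backward objective of an ordering of all fault locations is its total service
disruption time. -/
theorem sum_W_mul_eq_totalT (d : ℕ → ℕ → ℝ) (hrefl : ∀ i ∈ Finset.Icc 1 n, pre i i)
    (hσ : Set.BijOn σ (Set.Icc 1 n) (Set.Icc 1 n)) :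
    ∑ p ∈ Finset.Icc 1 n, (W n pre (Finset.Icc 1 n \ (Finset.Icc p n).image σ) : ℝ) *
        d (if p = 1 then 0 else σ (p - 1)) (σ p) = totalT n d pre σ := by
  have harr : ∀ i ∈ Finset.Icc 1 n, arrival d σ (lastPos n pre σ i)
      = ∑ p ∈ Finset.Icc 1 n,
        if p ≤ lastPos n pre σ i then d (jseq σ (p - 1)) (jseq σ p) else 0 := by
    intro i hi
    have hlast := Finset.mem_Icc.mp (lastPos_mem hrefl hσ hi).1
    rw [arrival, ← Finset.sum_filter]
    congr 1
    ext p
    simp only [Finset.mem_filter, Finset.mem_Icc]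
    omega
  rw [totalT, Finset.sum_congr rfl harr, Finset.sum_comm]
  refine Finset.sum_congr rfl fun p hp => ?_
  have hp1 := (Finset.mem_Icc.mp hp).1
  rw [W_sdiff_image hrefl hσ hp1, ← Finset.sum_filter, Finset.sum_const, nsmul_eq_mul]
  have hprev : jseq σ (p - 1) = if p = 1 then 0 else σ (p - 1) := by
    simp only [jseq, show p - 1 = 0 ↔ p = 1 by omega]
  have hcur : jseq σ p = σ p := if_neg (by omega)
  rw [hprev, hcur]

end Restoration

/-- The backward value at the initial state equals the optimal
objective: `v(0, V_c) = min_σ T(σ)` over all repair sequences `σ`. -/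
theorem stmt14
    (n : ℕ) (hn : 1 ≤ n)
    (d : ℕ → ℕ → ℝ) (hd : ∀ i j, 0 ≤ d i j)
    (pre : ℕ → ℕ → Prop)
    (hrefl : ∀ i ∈ Finset.Icc 1 n, pre i i)
    (htrans : ∀ i j k, pre i j → pre j k → pre i k)
    (hantisymm : ∀ i j, pre i j → pre j i → i = j)
    :
    vval n d pre 0 (Finset.Icc 1 n)
      = sInf { c : ℝ | ∃ σ : ℕ → ℕ,
          Set.BijOn σ (Set.Icc 1 n) (Set.Icc 1 n) ∧ c = totalT n d pre σ } := by
  simp only [vval, Nat.card_Icc, Nat.add_sub_cancel, Finset.coe_Icc]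
  congr 1
  ext c
  refine exists_congr fun σ => and_congr_right fun hσ => ?_
  rw [sum_W_mul_eq_totalT d hrefl hσ]
end
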